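/- arXiv:1606.07523 — 4 statements merged into one kernel-verified Lean document; each statement's English description precedes it below -/
import Mathlib

section
/- The minimum spanning tree routing function is robust: if e is an edge of a connected weighted graph G with pairwise distinct edge weights such that G−e is connected, then every vertex v whose unique path to the destination d in the (unique) minimum spanning tree of G does not use e has exactly the same path to d in the (unique) minimum spanning tree of G−e. -/
open SimpleGraph

variable {V : Type*} [Fintype V] [DecidableEq V]

/-- The total weight of (the edges of) a graph. -/
noncomputable def treeWeight (T : SimpleGraph V) (W : Sym2 V → ℝ) : ℝ :=
  ∑ᶠ e ∈ T.edgeSet, W e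

/-- `T` is a minimum spanning tree of the weighted graph `(G, W)`. -/
def IsMST (G : SimpleGraph V) (W : Sym2 V → ℝ) (T : SimpleGraph V) : Prop :=
  T ≤ G ∧ T.IsTree ∧
    ∀ T' : SimpleGraph V, T' ≤ G → T'.IsTree → treeWeight T W ≤ treeWeight T' W

/-- Replacing an edge of a finite tree by an edge joining the two resulting components
yields a tree. -/
theorem SimpleGraph.IsTree.deleteEdges_sup_edge {V : Type*} [Finite V] {T : SimpleGraph V}
    (hT : T.IsTree) {g : Sym2 V} (hg : g ∈ T.edgeSet) {a b : V} (hab : ¬ (T.deleteEdges {g}).Reachable a b) :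
    (T.deleteEdges {g} ⊔ edge a b).IsTree ∧
      (T.deleteEdges {g} ⊔ edge a b).edgeSet = insert s(a, b) (T.edgeSet \ {g}) ∧
      s(a, b) ∉ T.edgeSet \ {g} := by
  have hne : a ≠ b := by rintro rfl; exact hab (Reachable.refl _)
  have hedges : (T.deleteEdges {g} ⊔ edge a b).edgeSet = insert s(a, b) (T.edgeSet \ {g}) := by
    rw [edgeSet_sup, edgeSet_deleteEdges, edgeSet_edge_of_ne hne, Set.union_singleton]
  have hnot : s(a, b) ∉ T.edgeSet \ {g} := by
    rw [← edgeSet_deleteEdges]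
    exact fun h => hab (Adj.reachable h)
  refine ⟨?_, hedges, hnot⟩
  have hacyc : (T.deleteEdges {g} ⊔ edge a b).IsAcyclic :=
    (hT.isAcyclic.anti (deleteEdges_le _)).sup_edge_of_not_reachable hab
  have : Nonempty V := ⟨a⟩
  obtain ⟨S, hle, -, hS⟩ :=
    (connected_top (V := V)).exists_isTree_le_of_le_of_isAcyclic le_top hacyc
  have hcardS := (isTree_iff_connected_and_card.1 hS).2
  have hcardT := (isTree_iff_connected_and_card.1 hT).2
  have hcard : (T.deleteEdges {g} ⊔ edge a b).edgeSet.ncard = T.edgeSet.ncard := by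
    rw [hedges, Set.ncard_insert_of_notMem hnot (Set.toFinite _),
      Set.ncard_sdiff_singleton_add_one hg (Set.toFinite _)]
  have heq : (T.deleteEdges {g} ⊔ edge a b).edgeSet = S.edgeSet := by
    refine Set.eq_of_subset_of_ncard_le (edgeSet_mono hle) ?_ (Set.toFinite _)
    rw [hcard]
    simp only [Nat.card_coe_set_eq] at hcardS hcardT
    omega
  rwa [edgeSet_injective heq]

/-- An edge of a minimum spanning tree is no heavier than any edge that can replace it. -/
theorem IsMST.weight_le {V : Type*} [Finite V] {G T : SimpleGraph V} {W : Sym2 V → ℝ}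
    (hT : IsMST G W T) {g : Sym2 V} (hg : g ∈ T.edgeSet) {a b : V} (hadj : G.Adj a b)
    (hab : ¬ (T.deleteEdges {g}).Reachable a b) : W g ≤ W s(a, b) := by
  obtain ⟨htree, hedges, hnot⟩ := hT.2.1.deleteEdges_sup_edge hg hab
  have hmin := hT.2.2 _ (sup_le ((deleteEdges_le _).trans hT.1)
    ((edge_le_iff _).2 (Or.inr hadj))) htree
  rw [treeWeight, treeWeight, hedges, finsum_mem_insert W hnot (Set.toFinite _),
    ← Set.insert_eq_of_mem hg, ← Set.insert_sdiff_singleton,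
    finsum_mem_insert W (by simp) (Set.toFinite _)] at hmin
  simpa using hmin

/-- In an acyclic graph, deleting an edge of a path disconnects the endpoints of the path. -/
theorem SimpleGraph.IsAcyclic.not_reachable_deleteEdges {V : Type*} {T : SimpleGraph V}
    (hT : T.IsAcyclic) {a b : V} {q : T.Walk a b} (hq : q.IsPath) {g : Sym2 V}
    (hg : g ∈ q.edges) : ¬ (T.deleteEdges {g}).Reachable a b := by
  intro h
  obtain ⟨r, hr⟩ := h.exists_isPath
  have heq := congrArg Subtype.val
    ((hT.subsingleton_path a b).elim ⟨q, hq⟩ ⟨r.mapLe (deleteEdges_le _), hr.mapLe _⟩)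
  simp only at heq
  rw [heq, Walk.edges_mapLe_eq_edges] at hg
  have := r.edges_subset_edgeSet hg
  simp [edgeSet_deleteEdges] at this

/-- Deleting an edge `e` keeps all other edges of the minimum spanning tree. -/
theorem IsMST.mem_edgeSet_of_deleteEdges {V : Type*} [Finite V] {G T T' : SimpleGraph V}
    {W : Sym2 V → ℝ} {e f : Sym2 V}
    (hW : Set.InjOn W G.edgeSet) (hT : IsMST G W T) (hT' : IsMST (G.deleteEdges {e}) W T')
    (hf : f ∈ T.edgeSet) (hfe : f ≠ e) : f ∈ T'.edgeSet := by
  by_contra hfT'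
  induction f with | _ a b =>
  rw [mem_edgeSet] at hf
  have hbridge : ¬ (T.deleteEdges {s(a, b)}).Reachable a b :=
    hT.2.1.isAcyclic.not_reachable_deleteEdges (Walk.IsPath.of_adj hf) (by simp [Adj.toWalk])
  obtain ⟨q, hq⟩ := (hT'.2.1.connected a b).exists_isPath
  obtain ⟨c, hc, hca, hcb⟩ := q.exists_boundary_dart
    {x | (T.deleteEdges {s(a, b)}).Reachable a x} (Reachable.refl a) hbridge
  have hcG : G.Adj c.fst c.snd := deleteEdges_le _ (hT'.1 c.adj)
  have h₁ : W s(a, b) ≤ W s(c.fst, c.snd) :=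
    hT.weight_le hf hcG fun h => hcb (Reachable.trans hca h)
  have hcq : s(c.fst, c.snd) ∈ q.edges := List.mem_map.2 ⟨c, hc, rfl⟩
  have h₂ : W s(c.fst, c.snd) ≤ W s(a, b) :=
    hT'.weight_le c.adj (deleteEdges_adj.2 ⟨hT.1 hf, by simpa using hfe⟩)
      (hT'.2.1.isAcyclic.not_reachable_deleteEdges hq hcq)
  have heq := hW (hT.1 hf : G.Adj a b) hcG (le_antisymm h₁ h₂)
  exact hfT' (heq ▸ c.adj)

/-- minimum spanning tree routing is robust.  If `e` is an edge of a
connected weighted graph `G` with pairwise distinct edge weights such that `G − e` is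
connected, then every vertex `v` whose unique path to `d` in the minimum spanning tree
`T` of `G` avoids `e` has exactly the same path to `d` in the minimum spanning tree `T'`
of `G − e`. -/
theorem mst_robust
    (G : SimpleGraph V) (W : Sym2 V → ℝ) (d : V) (e : Sym2 V)
    (hG : G.Connected) (hW : Set.InjOn W G.edgeSet)
    (he : e ∈ G.edgeSet) (hG' : (G.deleteEdges {e}).Connected)
    (T T' : SimpleGraph V)
    (hT : IsMST G W T) (hT' : IsMST (G.deleteEdges {e}) W T')
    (v : V) (p : T.Walk v d) (hp : p.IsPath) (hep : e ∉ p.edges) :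
    ∃ q : T'.Walk v d, q.IsPath ∧ q.edges = p.edges := by
  have hmem : ∀ f ∈ p.edges, f ∈ T'.edgeSet := fun f hf =>
    hT.mem_edgeSet_of_deleteEdges hW hT' (p.edges_subset_edgeSet hf) fun h => hep (h ▸ hf)
  exact ⟨p.transfer T' hmem, hp.transfer hmem, p.edges_transfer hmem⟩
end

section
/- The minimum spanning tree routing function satisfies first hop: let G=(V,E,W) be a connected weighted graph with pairwise distinct edge weights, d a destination, T the unique minimum spanning tree of G, and v≠d a vertex. Let C={c₁,…,c_s} be the set of neighbors c of v such that T contains a path from c to d avoiding v, and let (v,c₁) be the first edge of v's unique path to d in T. Then W(v,c₁)<W(v,c_i) for all i≥2; consequently, for any weight function W' with pairwise distinct values agreeing with W on the edges (v,c_i), if in the unique minimum spanning tree T' of (V,E,W') every c_i∈C has a path to d avoiding v and no neighbor of v outside C has a path to d in T' avoiding v, then v's path to d in T' also starts with (v,c₁). -/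
open SimpleGraph

variable {V : Type*} [Fintype V] [DecidableEq V]

/-- Replacing an edge `s(v, a)` of a tree by an edge from `v` to a vertex `c` on the side of `a`
yields a tree. -/
theorem SimpleGraph.IsTree.deleteEdges_sup_edge_s7 {α : Type*} {T : SimpleGraph α} (hT : T.IsTree)
    {v a c : α} (hva : T.Adj v a) (hvc : v ≠ c)
    (hac : (T.deleteEdges {s(v, a)}).Reachable a c) :
    (T.deleteEdges {s(v, a)} ⊔ edge v c).IsTree := by
  have hbridge : ¬ (T.deleteEdges {s(v, a)}).Reachable v a :=
    isBridge_iff.1 (isAcyclic_iff_forall_adj_isBridge.1 hT.isAcyclic hva)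
  have hvc' : ¬ (T.deleteEdges {s(v, a)}).Reachable v c := fun h ↦ hbridge (h.trans hac.symm)
  have hva' : (T.deleteEdges {s(v, a)} ⊔ edge v c).Reachable v a :=
    (Adj.reachable (Or.inr ((adj_edge _ _).2 ⟨rfl, hvc⟩))).trans (hac.symm.mono le_sup_left)
  have hadj : ∀ x y, T.Adj x y → (T.deleteEdges {s(v, a)} ⊔ edge v c).Reachable x y := by
    intro x y hxy
    by_cases he : s(x, y) = s(v, a)
    · rcases Sym2.eq_iff.1 he with ⟨rfl, rfl⟩ | ⟨rfl, rfl⟩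
      · exact hva'
      · exact hva'.symm
    · exact Adj.reachable (Or.inl (deleteEdges_adj.2 ⟨hxy, he⟩))
  have hreach : ∀ x y, T.Walk x y → (T.deleteEdges {s(v, a)} ⊔ edge v c).Reachable x y := by
    intro x y w
    induction w with
    | nil => exact Reachable.refl _
    | cons h _ ih => exact (hadj _ _ h).trans ih
  have := hT.connected.nonempty
  exact ⟨⟨fun x y ↦ (hT.connected.preconnected x y).elim (hreach x y)⟩,
    (hT.isAcyclic.anti (deleteEdges_le _)).sup_edge_of_not_reachable hvc'⟩

/-- A walk avoiding a vertex survives the deletion of an edge at that vertex. -/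
theorem SimpleGraph.Walk.reachable_deleteEdges_of_notMem_support {α : Type*} {T : SimpleGraph α}
    {v a x y : α} (w : T.Walk x y) (hv : v ∉ w.support) :
    (T.deleteEdges {s(v, a)}).Reachable x y :=
  ⟨w.toDeleteEdges _ fun _ he h ↦ hv
    (w.fst_mem_support_of_mem_edges (Set.mem_singleton_iff.1 h ▸ he))⟩

theorem treeWeight_deleteEdges_sup_edge {α : Type*} [Finite α] (T : SimpleGraph α)
    (W : Sym2 α → ℝ) {v a c : α}
    (hva : T.Adj v a) (hvc : v ≠ c) (hnadj : ¬ T.Adj v c) :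
    treeWeight (T.deleteEdges {s(v, a)} ⊔ edge v c) W + W s(v, a) =
      treeWeight T W + W s(v, c) := by
  have hfin : (T.edgeSet \ {s(v, a)}).Finite := Set.toFinite _
  have hnew : (T.deleteEdges {s(v, a)} ⊔ edge v c).edgeSet =
      insert s(v, c) (T.edgeSet \ {s(v, a)}) := by
    rw [edgeSet_sup, edgeSet_deleteEdges, edgeSet_edge_of_ne hvc, Set.union_singleton]
  have hold : T.edgeSet = insert s(v, a) (T.edgeSet \ {s(v, a)}) := by
    rw [Set.insert_sdiff_singleton, Set.insert_eq_of_mem (T.mem_edgeSet.2 hva)]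
  have hsum := finsum_mem_insert W (a := s(v, a)) (s := T.edgeSet \ {s(v, a)}) (by simp) hfin
  rw [← hold] at hsum
  unfold treeWeight
  rw [hnew, finsum_mem_insert W (fun h ↦ hnadj h.1) hfin, hsum]
  ring

/-- In a minimum spanning tree, the first edge of the path from `v` to `d` is lighter than every
other edge from `v` to a vertex that reaches `d` while avoiding `v`. -/
theorem IsMST.weight_first_edge_lt {α : Type*} [Finite α] {G T : SimpleGraph α}
    {W : Sym2 α → ℝ} (hW : Set.InjOn W G.edgeSet) (hT : IsMST G W T) {d v a c : α} (hva : T.Adj v a)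
    {p : T.Walk a d} (hp : p.IsPath) (hvp : v ∉ p.support) (hvc : G.Adj v c)
    {q : T.Walk c d} (hq : q.IsPath) (hvq : v ∉ q.support) (hca : c ≠ a) :
    W s(v, a) < W s(v, c) := by
  obtain ⟨hTG, htree, hmin⟩ := hT
  have hnadj : ¬ T.Adj v c := by
    intro h
    have heq := congrArg (fun r : T.Path v d ↦ r.1.snd) ((htree.isAcyclic.subsingleton_path v d).elim
      ⟨.cons h q, hq.cons hvq⟩ ⟨.cons hva p, hp.cons hvp⟩)
    exact hca (by simpa using heq)
  have hac : (T.deleteEdges {s(v, a)}).Reachable a c :=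
    (p.reachable_deleteEdges_of_notMem_support hvp).trans
      (q.reachable_deleteEdges_of_notMem_support hvq).symm
  have hle := hmin _ (sup_le ((deleteEdges_le _).trans hTG) ((edge_le_iff _).2 (.inr hvc)))
    (htree.deleteEdges_sup_edge_s7 hva hvc.ne hac)
  have hweight := treeWeight_deleteEdges_sup_edge T W hva hvc.ne hnadj
  refine lt_of_le_of_ne (by linarith) fun h ↦ hca ?_
  exact (Sym2.congr_right.1 (hW (hTG hva) hvc h)).symm

/-- minimum spanning tree routing satisfies first hop.  Let `T` be the
(unique) minimum spanning tree of a connected weighted graph `(G, W)` with pairwise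
distinct edge weights, `v ≠ d`, let `C` be the set of neighbours `c` of `v` such that `T`
contains a path from `c` to `d` avoiding `v`, and let `(v, c₁)` be the first edge of
`v`'s unique path `p` to `d` in `T`.  Then `W(v, c₁) < W(v, c)` for every other `c ∈ C`;
consequently, for any weight function `W'` with pairwise distinct values agreeing with
`W` on the edges `(v, c)` for `c ∈ C`, if in the minimum spanning tree `T'` of
`(V, E, W')` every `c ∈ C` has a path to `d` avoiding `v` and no neighbour of `v`
outside `C` has a path to `d` in `T'` avoiding `v`, then `v`'s path to `d` in `T'` also
starts with `(v, c₁)`. -/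
theorem mst_first_hop
    (G : SimpleGraph V) (W : Sym2 V → ℝ) (d v : V)
    (hG : G.Connected) (hW : Set.InjOn W G.edgeSet) (hvd : v ≠ d)
    (T : SimpleGraph V) (hT : IsMST G W T)
    (C : Set V) (hC : C = {c : V | G.Adj v c ∧ ∃ q : T.Walk c d, q.IsPath ∧ v ∉ q.support})
    (c₁ : V) (p : T.Walk v d) (hp : p.IsPath) (hc₁ : p.getVert 1 = c₁) :
    (∀ c ∈ C, c ≠ c₁ → W s(v, c₁) < W s(v, c)) ∧
    (∀ W' : Sym2 V → ℝ, Set.InjOn W' G.edgeSet →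
      (∀ c ∈ C, W' s(v, c) = W s(v, c)) →
      ∀ T' : SimpleGraph V, IsMST G W' T' →
        (∀ c ∈ C, ∃ q : T'.Walk c d, q.IsPath ∧ v ∉ q.support) →
        (∀ c' : V, G.Adj v c' → (∃ q : T'.Walk c' d, q.IsPath ∧ v ∉ q.support) → c' ∈ C) →
        ∀ q : T'.Walk v d, q.IsPath → q.getVert 1 = c₁) := by
  subst hC
  cases p with
  | nil => exact absurd rfl hvd
  | @cons _ a _ hva p =>
    obtain ⟨hp, hvp⟩ := (Walk.cons_isPath_iff _ _).1 hp
    obtain rfl : a = c₁ := by simpa using hc₁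
    have hlt : ∀ c ∈ {c : V | G.Adj v c ∧ ∃ q : T.Walk c d, q.IsPath ∧ v ∉ q.support},
        c ≠ a → W s(v, a) < W s(v, c) := by
      rintro c ⟨hvc, q, hq, hvq⟩ hca
      exact hT.weight_first_edge_lt hW hva hp hvp hvc hq hvq hca
    refine ⟨hlt, ?_⟩
    intro W' hW' hagree T' hT' hin hout q hq
    cases q with
    | nil => exact absurd rfl hvd
    | @cons _ b _ hvb q =>
      obtain ⟨hq, hvq⟩ := (Walk.cons_isPath_iff _ _).1 hq
      have hb := hout b (hT'.1 hvb) ⟨q, hq, hvq⟩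
      have ha : a ∈ {c : V | G.Adj v c ∧ ∃ q : T.Walk c d, q.IsPath ∧ v ∉ q.support} :=
        ⟨hT.1 hva, p, hp, hvp⟩
      obtain ⟨r, hr, hvr⟩ := hin a ha
      by_contra hne
      have hba : b ≠ a := by simpa using hne
      have hlt' := hT'.weight_first_edge_lt hW' hvb hq hvq (hT.1 hva) hr hvr hba.symm
      rw [hagree a ha, hagree b hb] at hlt'
      exact lt_asymm hlt' (hlt b hb hba)
end

section
/- Weakest link routing is inverse monotone: let G=(V,E,W) be a connected weighted graph, d∈V, and let e'∈E be an edge such that G−e' is connected and e' does not lie on the unique maximin path from v to d for any vertex v. Then for every weight function W':E→ℝ there exists m∈ℝ (e.g., strictly below the minimum W'-weight of the other edges) such that for every weight function W'' agreeing with W' on E∖{e'} with W''(e')≤m, the edge e' does not lie on any maximin path from any vertex to d in (V,E,W''). -/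
open SimpleGraph

variable {V : Type*} [Fintype V] [DecidableEq V]

/-- The value of a walk: the minimum of the weights of its edges (`⊤` for the empty walk). -/
noncomputable def walkValue {G : SimpleGraph V} {u v : V} (W : Sym2 V → ℝ)
    (p : G.Walk u v) : WithTop ℝ :=
  (p.edges.map W).minimum

/-- `p` is a maximin (weakest link) path from `u` to `d` in `G` with respect to `W`:
a path maximizing the minimum edge weight. -/
def IsMaximinPath (G : SimpleGraph V) (W : Sym2 V → ℝ) (u d : V) (p : G.Walk u d) : Prop :=
  p.IsPath ∧ ∀ q : G.Walk u d, q.IsPath → walkValue W q ≤ walkValue W p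

theorem walkValue_le_of_mem_edges {V : Type*} {G : SimpleGraph V} {u v : V} (W : Sym2 V → ℝ)
    {p : G.Walk u v} {e : Sym2 V} (he : e ∈ p.edges) : walkValue W p ≤ W e :=
  List.minimum_le_of_mem' (List.mem_map_of_mem he)

theorem lt_walkValue {V : Type*} {G : SimpleGraph V} {u v : V} (W : Sym2 V → ℝ)
    {p : G.Walk u v} {c : ℝ} (h : ∀ e ∈ p.edges, c < W e) : (c : WithTop ℝ) < walkValue W p := by
  by_contra! hle
  obtain ⟨m, hm⟩ := WithTop.ne_top_iff_exists.mp (hle.trans_lt (WithTop.coe_lt_top c)).ne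
  obtain ⟨e, he, rfl⟩ := List.mem_map.mp (List.minimum_mem hm.symm)
  rw [← hm, WithTop.coe_le_coe] at hle
  exact (h e he).not_ge hle

/-- weakest link routing is inverse monotone.  Let `(G, W)` be a connected
weighted graph in which maximin paths to `d` are unique, and let `e'` be an edge such
that `G − e'` is connected and `e'` does not lie on the maximin path from `v` to `d`
for any vertex `v`.  Then for every weight function `W'` there is a threshold `m` such
that for every `W''` agreeing with `W'` on `E ∖ {e'}` with `W''(e') ≤ m`, the edge `e'`
does not lie on any maximin path from any vertex to `d` in `(V, E, W'')`. -/
theorem weakest_link_inverse_monotone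
    (G : SimpleGraph V) (W : Sym2 V → ℝ) (d : V) (e' : Sym2 V)
    (hG : G.Connected) (he' : e' ∈ G.edgeSet) (hG' : (G.deleteEdges {e'}).Connected)
    (huniq : ∀ (u : V) (p q : G.Walk u d),
      IsMaximinPath G W u d p → IsMaximinPath G W u d q → p = q)
    (havoid : ∀ (u : V) (p : G.Walk u d), IsMaximinPath G W u d p → e' ∉ p.edges) :
    ∀ W' : Sym2 V → ℝ, ∃ m : ℝ, ∀ W'' : Sym2 V → ℝ,
      (∀ e ∈ G.edgeSet, e ≠ e' → W'' e = W' e) → W'' e' ≤ m →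
      ∀ (u : V) (p : G.Walk u d), IsMaximinPath G W'' u d p → e' ∉ p.edges := by
  intro W'
  obtain ⟨b, hb⟩ := (Set.finite_range W').bddBelow
  refine ⟨b - 1, fun W'' hagree hle u p hp hmem => ?_⟩
  obtain ⟨r, hr⟩ := (hG'.preconnected u d).exists_isPath
  have hsub : G.deleteEdges {e'} ≤ G := G.deleteEdges_le {e'}
  refine (hp.2 (r.mapLe hsub) (hr.mapLe hsub)).not_gt
    ((walkValue_le_of_mem_edges W'' hmem).trans_lt (lt_walkValue W'' fun e he => ?_))
  rw [Walk.edges_mapLe_eq_edges] at he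
  have hedge := r.edges_subset_edgeSet he
  rw [edgeSet_deleteEdges] at hedge
  rw [hagree e hedge.1 hedge.2]
  linarith [hb (Set.mem_range_self e)]
end

section
/- Weakest link routing is path ordinal invariant: let G=(V,E,W) be a weighted graph containing exactly one cycle, d∈V, and let v≠d lie on this cycle, giving exactly two alternative paths p₁ and p₂ from v to d. Let e'∈p_i (i∈{1,2}) be an edge whose weight is neither maximal nor minimal among the edges of p₁∪p₂, and let W' agree with W except at e', where W'(e') is any value satisfying: for every e''∈p_i, W(e')≥W(e'') if and only if W'(e')≥W(e''). Then p₁ has value (minimum edge weight) at least that of p₂ under W if and only if the same holds under W'; in particular the maximin path from v to d is unchanged. -/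
/-- A bound lying below every weight that increases cannot tell the old minimum from the
new one. -/
theorem List.le_minimum_map_iff_of_raised {α β : Type*} [LinearOrder β] {f g : α → β}
    {t c : WithTop β} (hfg : ∀ a, g a = f a ∨ t ≤ f a ∧ f a ≤ g a) (hc : c ≤ t) (l : List α) :
    c ≤ (l.map f).minimum ↔ c ≤ (l.map g).minimum := by
  induction l with
  | nil => simp
  | cons a l ih =>
    simp only [List.map_cons, List.minimum_cons, le_min_iff, ih]
    refine and_congr_left fun _ => ?_
    rcases hfg a with h | ⟨h₁, h₂⟩
    · rw [h]
    · have h₃ : c ≤ f a := hc.trans h₁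
      exact iff_of_true h₃ (h₃.trans (WithTop.coe_le_coe.2 h₂))

/-- If two pairs satisfy the same lower bounds up to `t`, and one entry of the first pair is
below `t`, then both pairs are ordered in the same way. -/
theorem le_iff_le_of_truncated_eq {β : Type*} [LinearOrder β] {t x y x' y' : β}
    (hx : ∀ c ≤ t, (c ≤ x ↔ c ≤ x')) (hy : ∀ c ≤ t, (c ≤ y ↔ c ≤ y'))
    (hxy : x < t ∨ y < t) : y ≤ x ↔ y' ≤ x' := by
  have aux : ∀ {z z' : β}, (∀ c ≤ t, (c ≤ z ↔ c ≤ z')) → z < t → z' = z := by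
    intro z z' h hz
    have hz' : z' < t := by simpa using (h t le_rfl).not.1 hz.not_ge
    exact le_antisymm ((h z' hz'.le).2 le_rfl) ((h z hz.le).1 le_rfl)
  rcases lt_or_ge x t with hxt | hxt <;> rcases lt_or_ge y t with hyt | hyt
  · rw [aux hx hxt, aux hy hyt]
  · rw [aux hx hxt]
    exact iff_of_false (hxt.trans_le hyt).not_ge (hxt.trans_le ((hy t le_rfl).1 hyt)).not_ge
  · rw [aux hy hyt]
    exact iff_of_true (hyt.le.trans hxt) (hyt.le.trans ((hx t le_rfl).1 hxt))
  · exact absurd hxy (by simp [hxt, hyt])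


open SimpleGraph

variable {V : Type*} [Fintype V] [DecidableEq V]

/-- weakest link routing is path ordinal invariant.  Let `(G, W)` be a
weighted graph containing exactly one cycle (a connected graph with as many edges as
vertices), let `v ≠ d` lie on this cycle, giving exactly two alternative paths `p₁, p₂`
from `v` to `d`.  Let `e'` be an edge of one of them (`pa ∈ {p₁, p₂}`), of weight
neither maximal nor minimal among the edges of `p₁ ∪ p₂`, and let `W'` agree with `W`
except at `e'`, where for every `e'' ∈ pa`, `W(e') ≥ W(e'')` iff `W'(e') ≥ W(e'')`.
Then `p₁` has value (minimum edge weight) at least that of `p₂` under `W` iff the same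
holds under `W'`; in particular the maximin path from `v` to `d` is unchanged. -/
theorem weakest_link_ordinal_invariant
    (G : SimpleGraph V) (W : Sym2 V → ℝ) (d v : V)
    (hG : G.Connected) (hcyc : G.edgeSet.ncard = Fintype.card V) (hvd : v ≠ d)
    (p₁ p₂ pa : G.Walk v d) (hp₁ : p₁.IsPath) (hp₂ : p₂.IsPath) (hne : p₁ ≠ p₂)
    (hall : ∀ q : G.Walk v d, q.IsPath → q = p₁ ∨ q = p₂)
    (hpa : pa = p₁ ∨ pa = p₂)
    (e' : Sym2 V) (he' : e' ∈ pa.edges)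
    (hnotmax : ∃ b : Sym2 V, (b ∈ p₁.edges ∨ b ∈ p₂.edges) ∧ W e' < W b)
    (hnotmin : ∃ a : Sym2 V, (a ∈ p₁.edges ∨ a ∈ p₂.edges) ∧ W a < W e')
    (W' : Sym2 V → ℝ) (hagree : ∀ e : Sym2 V, e ≠ e' → W' e = W e)
    (hord : ∀ e'' ∈ pa.edges, (W e'' ≤ W e' ↔ W e'' ≤ W' e')) :
    (walkValue W p₂ ≤ walkValue W p₁ ↔ walkValue W' p₂ ≤ walkValue W' p₁) ∧
    (∀ q : G.Walk v d, IsMaximinPath G W v d q ↔ IsMaximinPath G W' v d q) := by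
  have hraise : W e' ≤ W' e' := (hord e' he').1 le_rfl
  have hfg : ∀ e, W' e = W e ∨ ((W e' : ℝ) : WithTop ℝ) ≤ W e ∧ W e ≤ W' e := by
    intro e
    by_cases h : e = e'
    · subst h
      exact Or.inr ⟨le_rfl, hraise⟩
    · exact Or.inl (hagree e h)
  have hval : ∀ q : G.Walk v d, ∀ c ≤ ((W e' : ℝ) : WithTop ℝ),
      (c ≤ walkValue W q ↔ c ≤ walkValue W' q) := fun q _ hc =>
    List.le_minimum_map_iff_of_raised hfg hc q.edges
  have hlow : walkValue W p₁ < W e' ∨ walkValue W p₂ < W e' := by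
    obtain ⟨a, ha, hlt⟩ := hnotmin
    have hbound : ∀ q : G.Walk v d, a ∈ q.edges → walkValue W q < W e' := fun q h =>
      (List.minimum_le_of_mem' (List.mem_map_of_mem h)).trans_lt (WithTop.coe_lt_coe.2 hlt)
    exact ha.imp (hbound p₁) (hbound p₂)
  have h₁₂ := le_iff_le_of_truncated_eq (hval p₁) (hval p₂) hlow
  have h₂₁ := le_iff_le_of_truncated_eq (hval p₂) (hval p₁) hlow.symm
  refine ⟨h₁₂, fun q => and_congr_right fun hq => forall₂_congr fun r hr => ?_⟩
  rcases hall q hq with rfl | rfl <;> rcases hall r hr with rfl | rfl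
  · simp
  · exact h₁₂
  · exact h₂₁
  · simp
end
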